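/- The set Y of all points that δ-trace some pair (C̃, r) with C̃ a sequence of orbit segments of length N from a finite set E and r a sequence of gaps bounded by τ, is a compact subset of X. Precisely: Y := ∪_{C ∈ E^{ℤ⁺}, r ∈ {0,…,τ-1}^{ℤ⁺}} Y(C,r) is compact, where Y(C,r) is the set of points z such that d(f^{t_k + j}(z), f^j(x_k)) ≤ δ for all k ≥ 1 and 0 ≤ j ≤ N-1, with t_1 = 0 and t_k = Σ_{i<k}(N + r_i). -/

import Mathlib

open Filter Topology

/-- The transition times `t_k = Σ_{i<k} (N + r_i)` (so `t_0 = 0`). -/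
def ttime (N : ℕ) (r : ℕ → ℕ) (k : ℕ) : ℕ :=
  ∑ i ∈ Finset.range k, (N + r i)

/-- `z` δ-traces the sequence of orbit segments `(C k, N)` with gaps `r`:
`d(f^{t_k + j} z, f^j (C k)) ≤ δ` for all `k` and `0 ≤ j < N`. -/
def Traces {X : Type*} [MetricSpace X] (f : X → X) (N : ℕ) (δ : ℝ)
    (C : ℕ → X) (r : ℕ → ℕ) (z : X) : Prop :=
  ∀ k, ∀ j < N, dist (f^[ttime N r k + j] z) (f^[j] (C k)) ≤ δ

/-- The set of all δ-tracing points of sequences of length-`N` orbit segments from `E`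
with gaps in `{0,…,τ-1}`. -/
def TraceSet {X : Type*} [MetricSpace X] (f : X → X) (E : Finset X) (N τ : ℕ) (δ : ℝ) :
    Set X :=
  {z | ∃ (C : ℕ → X) (r : ℕ → ℕ), (∀ k, C k ∈ E) ∧ (∀ k, r k < τ) ∧ Traces f N δ C r z}

theorem continuous_ttime (N k : ℕ) : Continuous fun r : ℕ → ℕ => ttime N r k := by
  unfold ttime
  fun_prop

theorem continuous_uncurry_iterate {X : Type*} [TopologicalSpace X] {f : X → X}
    (hf : Continuous f) : Continuous fun p : ℕ × X => f^[p.1] p.2 :=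
  continuous_prod_of_discrete_left.2 fun n => hf.iterate n

/-- The tracing relation is closed, jointly in the traced point, the segments and the gaps. -/
theorem isClosed_setOf_traces {X : Type*} [MetricSpace X] {f : X → X} (hf : Continuous f)
    (N : ℕ) (δ : ℝ) :
    IsClosed {p : X × (ℕ → X) × (ℕ → ℕ) | Traces f N δ p.2.1 p.2.2 p.1} := by
  simp only [Traces, Set.ofPred_forall]
  refine isClosed_iInter fun k => isClosed_iInter fun j => isClosed_iInter fun _ => ?_
  refine isClosed_le (Continuous.dist ?_ ?_) continuous_const
  · have htime : Continuous fun p : X × (ℕ → X) × (ℕ → ℕ) => ttime N p.2.2 k + j :=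
      ((continuous_ttime N k).comp (by fun_prop)).add continuous_const
    exact (continuous_uncurry_iterate hf).comp (htime.prodMk continuous_fst)
  · exact (hf.iterate j).comp (by fun_prop)

theorem traceSet_eq_image_fst {X : Type*} [MetricSpace X] (f : X → X) (E : Finset X)
    (N τ : ℕ) (δ : ℝ) :
    TraceSet f E N τ δ = Prod.fst ''
      ((Set.univ ×ˢ (Set.univ.pi fun _ : ℕ => (E : Set X)) ×ˢ
          (Set.univ.pi fun _ : ℕ => Set.Iio τ)) ∩
        {p : X × (ℕ → X) × (ℕ → ℕ) | Traces f N δ p.2.1 p.2.2 p.1}) := by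
  ext z
  simp [TraceSet, Set.mem_pi, and_assoc]

/-- The set `Y = ∪_{C,r} Y(C,r)` of all δ-tracing points is compact. -/
theorem traceSet_isCompact {X : Type*} [MetricSpace X] [CompactSpace X]
    (f : X → X) (hf : Continuous f) (E : Finset X) (N τ : ℕ) (hN : 1 ≤ N) (hτ : 1 ≤ τ)
    (δ : ℝ) (hδ : 0 < δ) :
    IsCompact (TraceSet f E N τ δ) := by
  rw [traceSet_eq_image_fst]
  have hE : IsCompact (Set.univ.pi fun _ : ℕ => (E : Set X)) :=
    isCompact_univ_pi fun _ => E.finite_toSet.isCompact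
  have hgaps : IsCompact (Set.univ.pi fun _ : ℕ => Set.Iio τ) :=
    isCompact_univ_pi fun _ => (Set.finite_Iio τ).isCompact
  exact ((isCompact_univ.prod (hE.prod hgaps)).inter_right
    (isClosed_setOf_traces hf N δ)).image continuous_fst
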